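/- Suppose t ≠ 0 and f ∈ D_t. The operator equations T z^k = λ_k f(z^k) (k = 1, 2, ...) have a solution T that is an isometry on D_t if and only if f = c z^N for some positive integer N and constant c with |c| = (N+1)^{−t/2}, and |λ_k| = ((kN + k + N + 1)/(kN + 1))^{t/2} for each k. -/

import Mathlib

open MeasureTheory

/-- The weighted counting measure on `ℕ` realizing the Dirichlet-type space `D_t` as
`L²`: index `n` carries weight `(n+2)^t`, corresponding to the monomial `z^{n+1}` whose
`D_t`-norm squared is `((n+1)+1)^t`. -/
noncomputable def dirichletMeasure (t : ℝ) : Measure ℕ :=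
  Measure.sum fun n : ℕ => (ENNReal.ofReal (((n : ℝ) + 2) ^ t)) • Measure.dirac n

/-- The Dirichlet-type space `D_t`, realized as a weighted `ℓ²`-space: coordinate `n` is
the Taylor coefficient of `z^{n+1}`. -/
noncomputable abbrev DirichletSpace (t : ℝ) : Type := Lp ℂ 2 (dirichletMeasure t)

section Isometry

variable {H : Type*} [NormedAddCommGroup H] [InnerProductSpace ℂ H]

lemma orthonormal_inv_norm_smul {ι : Type*} {r : ι → ℝ} (hr : ∀ i, r i ≠ 0) {v : ι → H}
    (hv : ∀ i, ‖v i‖ = r i) (ho : ∀ i j, i ≠ j → inner ℂ (v i) (v j) = 0) :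
    Orthonormal ℂ fun i => ((r i : ℝ) : ℂ)⁻¹ • v i := by
  refine ⟨fun i => ?_, fun i j hij => ?_⟩
  · rw [norm_smul, norm_inv, Complex.norm_real, hv, ← hv, norm_norm]
    exact inv_mul_cancel₀ (hv i ▸ hr i)
  · simp only [inner_smul_left, inner_smul_right, ho i j hij, mul_zero]

/-- A total orthogonal family can be mapped isometrically onto any orthogonal family with the same
norms. -/
lemma exists_linearIsometry_of_orthogonal [CompleteSpace H] {ι : Type*} {z w : ι → H}
    (hz : ∀ i j, i ≠ j → inner ℂ (z i) (z j) = 0) (hz0 : ∀ i, z i ≠ 0)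
    (htot : ∀ g, (∀ i, inner ℂ (z i) g = 0) → g = 0)
    (hw : ∀ i j, i ≠ j → inner ℂ (w i) (w j) = 0) (hzw : ∀ i, ‖w i‖ = ‖z i‖) :
    ∃ T : H →ₗᵢ[ℂ] H, ∀ i, T (z i) = w i := by
  classical
  have hn (i : ι) : ‖z i‖ ≠ 0 := norm_ne_zero_iff.2 (hz0 i)
  have hnc (i : ι) : ((‖z i‖ : ℝ) : ℂ) ≠ 0 := Complex.ofReal_ne_zero.2 (hn i)
  have hoz := orthonormal_inv_norm_smul hn (fun _ => rfl) hz
  have how := orthonormal_inv_norm_smul hn hzw hw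
  let b : HilbertBasis ι ℂ H := HilbertBasis.mkOfOrthogonalEqBot hoz (by
    refine (Submodule.eq_bot_iff _).2 fun g hg => htot g fun i => ?_
    have := (Submodule.mem_orthogonal _ _).1 hg _ (Submodule.subset_span ⟨i, rfl⟩)
    rw [inner_smul_left, mul_eq_zero] at this
    exact this.resolve_left (by simpa using hz0 i))
  have hb (i : ι) : b i = ((‖z i‖ : ℝ) : ℂ)⁻¹ • z i := by
    simp only [b, HilbertBasis.coe_mkOfOrthogonalEqBot]
  refine ⟨how.orthogonalFamily.linearIsometry.comp b.repr.toLinearIsometry, fun i => ?_⟩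
  have e : z i = ((‖z i‖ : ℝ) : ℂ) • b i := by rw [hb, smul_inv_smul₀ (hnc i)]
  conv_lhs => rw [e]
  rw [map_smul, LinearIsometry.coe_comp, Function.comp_apply, LinearIsometryEquiv.coe_toLinearIsometry,
    HilbertBasis.repr_self, OrthogonalFamily.linearIsometry_apply_single,
    LinearIsometry.toSpanSingleton_apply, one_smul, smul_inv_smul₀ (hnc i)]

end Isometry

section Asymptotics

open Filter Topology

lemma tsum_eq_zero_of_dilates {Q : ℕ → ℂ} (hQ : Summable Q) {G : ℝ → ℝ}
    (hG : ContinuousOn G (Set.Icc 0 1)) (hG0 : G 0 ≠ 0)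
    (h : ∀ d : ℕ, 0 < d → ∑' n : ℕ, (G (1 / (d * n)) : ℂ) * Q n = 0) : ∑' n, Q n = 0 := by
  obtain ⟨K, hK⟩ := isCompact_Icc.exists_bound_of_continuousOn hG
  have hmem (d n : ℕ) : 1 / ((d : ℝ) * n) ∈ Set.Icc (0 : ℝ) 1 := by
    refine ⟨by positivity, ?_⟩
    rw [← Nat.cast_mul, one_div]
    exact Nat.cast_inv_le_one _
  have hlim : Tendsto (fun d : ℕ => ∑' n : ℕ, (G (1 / (d * n)) : ℂ) * Q n) atTop
      (𝓝 (∑' n, (G 0 : ℂ) * Q n)) := by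
    refine tendsto_tsum_of_dominated_convergence (bound := fun n => K * ‖Q n‖)
      (hQ.norm.mul_left K) (fun n => ?_) (Eventually.of_forall fun d n => ?_)
    · refine Tendsto.mul_const _ ((Complex.continuous_ofReal.tendsto _).comp ?_)
      refine (hG 0 (by simp)).tendsto.comp (tendsto_nhdsWithin_iff.2
        ⟨?_, Eventually.of_forall fun d => hmem d n⟩)
      have := (tendsto_one_div_atTop_nhds_zero_nat (𝕜 := ℝ)).mul_const (1 / (n : ℝ))
      simpa [mul_comm] using this
    · rw [norm_mul, Complex.norm_real]
      gcongr
      exact hK _ (hmem d n)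
  have hz : Tendsto (fun d : ℕ => ∑' n : ℕ, (G (1 / (d * n)) : ℂ) * Q n) atTop (𝓝 0) :=
    tendsto_const_nhds.congr' ((eventually_gt_atTop 0).mono fun d hd => (h d hd).symm)
  have := tendsto_nhds_unique hlim hz
  rw [tsum_mul_left] at this
  exact (mul_eq_zero.1 this).resolve_left (by exact_mod_cast hG0)

lemma tsum_eq_zero_of_rpow_dilates {t : ℝ} (ht : t ≠ 0) {P : ℕ → ℂ} (hP : Summable P)
    (h : ∀ d : ℕ, 0 < d → ∑' n : ℕ, (((1 + 1 / (d * n) : ℝ) ^ t : ℝ) : ℂ) * P n = 0) :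
    ∑' n, P n = 0 ∧ ∑' n : ℕ, (n : ℂ)⁻¹ * P n = 0 := by
  set F : ℝ → ℝ := fun x => (1 + x) ^ t with hF
  have hder (x : ℝ) (hx : x ∈ Set.Icc (0 : ℝ) 1) : HasDerivAt F (t * (1 + x) ^ (t - 1)) x := by
    have := ((hasDerivAt_id x).const_add 1).rpow_const (p := t)
      (Or.inl (by have := hx.1; simp only [id]; linarith))
    simpa [hF, mul_comm] using this
  have hFc : ContinuousOn F (Set.Icc 0 1) := fun x hx =>
    (hder x hx).continuousAt.continuousWithinAt
  have h0 : ∑' n, P n = 0 := tsum_eq_zero_of_dilates hP hFc (by simp [hF]) h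
  refine ⟨h0, ?_⟩
  have hP' : Summable fun n : ℕ => (n : ℂ)⁻¹ * P n := by
    refine Summable.of_norm_bounded hP.norm fun n => ?_
    rw [norm_mul, norm_inv, Complex.norm_natCast]
    exact mul_le_of_le_one_left (norm_nonneg _) (Nat.cast_inv_le_one n)
  have hd0 : dslope F 0 0 = t := by
    rw [dslope_same, (hder 0 (by simp)).deriv]; simp
  refine tsum_eq_zero_of_dilates (G := dslope F 0) hP' ?_ (by rwa [hd0]) fun d hd => ?_
  · intro x hx
    rcases eq_or_ne x 0 with rfl | hx0
    · exact (continuousAt_dslope_same.2 (hder 0 hx).differentiableAt).continuousWithinAt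
    · exact (continuousWithinAt_dslope_of_ne hx0).2 (hFc x hx)
  · have hd' : (d : ℂ) ≠ 0 := by exact_mod_cast hd.ne'
    have key (n : ℕ) : ((dslope F 0 (1 / (d * n)) : ℝ) : ℂ) * ((n : ℂ)⁻¹ * P n) =
        (d : ℂ) * ((((1 + 1 / (d * n) : ℝ) ^ t : ℝ) : ℂ) * P n - P n) := by
      have e := sub_smul_dslope F 0 (1 / ((d : ℝ) * n))
      have e' : ((1 + 1 / (d * n) : ℝ) ^ t : ℝ) = 1 + 1 / (d * n) * dslope F 0 (1 / (d * n)) := by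
        simp only [hF, smul_eq_mul, sub_zero, add_zero, Real.one_rpow] at e ⊢
        linarith
      rw [e']
      push_cast
      rcases eq_or_ne (n : ℂ) 0 with hn | hn
      · simp [hn]
      · field_simp
        ring
    have hs : Summable fun n : ℕ => (((1 + 1 / (d * n) : ℝ) ^ t : ℝ) : ℂ) * P n := by
      obtain ⟨K, hK⟩ := isCompact_Icc.exists_bound_of_continuousOn hFc
      refine Summable.of_norm_bounded (hP.norm.mul_left K) fun n => ?_
      rw [norm_mul, Complex.norm_real]
      gcongr
      refine hK _ ⟨by positivity, ?_⟩
      rw [← Nat.cast_mul, one_div]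
      exact Nat.cast_inv_le_one _
    rw [tsum_congr key, tsum_mul_left, hs.tsum_sub hP, h d hd, h0]
    simp

end Asymptotics

/-- The extension of a sequence to the rationals, by zero off the natural numbers. -/
noncomputable def ratExtend (c : ℕ → ℂ) : ℚ → ℂ :=
  Function.extend (fun n : ℕ => (n : ℚ)) c 0

section ratExtend

open ComplexConjugate

variable {c : ℕ → ℂ}

@[simp] lemma ratExtend_natCast (n : ℕ) : ratExtend c n = c n :=
  Nat.cast_injective.extend_apply c 0 n

lemma exists_of_ratExtend_ne_zero {q : ℚ} (h : ratExtend c q ≠ 0) :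
    ∃ n : ℕ, (n : ℚ) = q ∧ c n ≠ 0 := by
  by_cases hq : ∃ n : ℕ, (n : ℚ) = q
  · obtain ⟨n, rfl⟩ := hq
    exact ⟨n, rfl, by simpa using h⟩
  · exact absurd (Function.extend_apply' _ _ _ hq) h

lemma ratExtend_div {k : ℕ} (hk : 0 < k) (n : ℕ) :
    ratExtend c (n / k) = if k ∣ n then c (n / k) else 0 := by
  have hk' : (k : ℚ) ≠ 0 := by exact_mod_cast hk.ne'
  split_ifs with h
  · rw [← Nat.cast_div h hk', ratExtend_natCast]
  · by_contra hne
    obtain ⟨m, hm, -⟩ := exists_of_ratExtend_ne_zero hne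
    rw [eq_div_iff hk'] at hm
    exact h ⟨m, by rw [mul_comm]; exact_mod_cast hm.symm⟩

lemma summable_ratExtend (hc : Summable fun n => ‖c n‖ ^ 2) :
    Summable fun q => ‖ratExtend c q‖ ^ 2 := by
  refine (Function.Injective.summable_iff (Nat.cast_injective (R := ℚ)) fun q hq => ?_).1
    (by simpa [Function.comp_def] using hc)
  by_contra hne
  obtain ⟨n, hn, -⟩ := exists_of_ratExtend_ne_zero (c := c) (q := q) (by simpa using hne)
  exact hq ⟨n, hn⟩

lemma injective_natCast_div {k : ℕ} (hk : 0 < k) :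
    Function.Injective fun n : ℕ => (n : ℚ) / k := by
  have hk' : (k : ℚ) ≠ 0 := by exact_mod_cast hk.ne'
  intro a b hab
  simpa [div_left_inj' hk'] using hab

lemma summable_conj_ratExtend_mul (hc : Summable fun n => ‖c n‖ ^ 2) {j k : ℕ} (hj : 0 < j)
    (hk : 0 < k) : Summable fun n : ℕ => conj (ratExtend c (n / j)) * ratExtend c (n / k) := by
  have h := summable_ratExtend hc
  refine Summable.of_norm_bounded ((h.comp_injective (injective_natCast_div hj)).add
    (h.comp_injective (injective_natCast_div hk))) fun n => ?_
  rw [norm_mul, RCLike.norm_conj]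
  simp only [Function.comp_apply]
  nlinarith [sq_nonneg (‖ratExtend c (n / j)‖ - ‖ratExtend c (n / k)‖),
    sq_nonneg ‖ratExtend c (n / j)‖, sq_nonneg ‖ratExtend c (n / k)‖]

lemma tsum_conj_ratExtend_mul_dilate (G : ℝ → ℝ) {d j k : ℕ} (hd : 0 < d) (hj : 0 < j) :
    ∑' n : ℕ, (G (1 / n) : ℂ) *
        (conj (ratExtend c (n / (d * j : ℕ))) * ratExtend c (n / (d * k : ℕ))) =
      ∑' n : ℕ, (G (1 / (d * n)) : ℂ) * (conj (ratExtend c (n / j)) * ratExtend c (n / k)) := by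
  have hd' : (d : ℚ) ≠ 0 := by exact_mod_cast hd.ne'
  have hj' : (j : ℚ) ≠ 0 := by exact_mod_cast hj.ne'
  rw [← (mul_right_injective₀ hd.ne').tsum_eq]
  · refine tsum_congr fun n => ?_
    simp only [Nat.cast_mul, mul_div_mul_left _ _ hd']
  · intro n hn
    obtain ⟨m, hm, -⟩ := exists_of_ratExtend_ne_zero (c := c) (q := n / (d * j : ℕ)) (by
      intro h0; exact hn (by simp only [h0, map_zero, zero_mul, mul_zero]))
    rw [eq_div_iff (by push_cast; positivity)] at hm
    refine ⟨j * m, ?_⟩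
    have : m * (d * j) = n := by exact_mod_cast hm
    simp only [← this]; ring

/-- If the Dirichlet dilates of a square summable sequence are orthogonal both for the counting
measure and for the weight `1 / n`, then at most one of its terms is nonzero. -/
theorem eq_of_ne_zero_of_orthogonal_dilates (hc0 : c 0 = 0) (hc : Summable fun n => ‖c n‖ ^ 2)
    (h0 : ∀ j k : ℕ, 0 < j → 0 < k → j ≠ k →
      ∑' n : ℕ, conj (ratExtend c (n / j)) * ratExtend c (n / k) = 0)
    (h1 : ∀ j k : ℕ, 0 < j → 0 < k → j ≠ k →
      ∑' n : ℕ, (n : ℂ)⁻¹ * (conj (ratExtend c (n / j)) * ratExtend c (n / k)) = 0)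
    {a b : ℕ} (ha : c a ≠ 0) (hb : c b ≠ 0) : a = b := by
  have hC := summable_ratExtend hc
  have hcR : Summable fun n : ℕ => (n : ℝ)⁻¹ * ‖c n‖ ^ 2 := by
    refine Summable.of_nonneg_of_le (fun n => by positivity) (fun n => ?_) hc
    exact mul_le_of_le_one_left (by positivity) (Nat.cast_inv_le_one n)
  set S : ℝ := ∑' n, ‖c n‖ ^ 2 with hS
  set R : ℝ := ∑' n : ℕ, (n : ℝ)⁻¹ * ‖c n‖ ^ 2 with hR
  have hpos {n : ℕ} (hn : c n ≠ 0) : 0 < n :=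
    Nat.pos_of_ne_zero (by rintro rfl; exact hn hc0)
  have hSpos : 0 < S := hc.tsum_pos (fun _ => by positivity) a (by positivity)
  have hRpos : 0 < R := by
    have := hpos ha
    exact hcR.tsum_pos (fun _ => by positivity) a (by positivity)
  have hqinj (n : ℕ+) : Function.Injective fun q : ℚ => q * (n : ℕ) :=
    mul_left_injective₀ (by simp)
  let v (n : ℕ+) : lp (fun _ : ℚ => ℂ) 2 := ⟨fun q => ratExtend c (q * (n : ℕ)), memℓp_gen (by
    simpa [Function.comp_def] using hC.comp_injective (hqinj n))⟩
  have hv (n : ℕ+) (q : ℚ) : v n q = ratExtend c (q * (n : ℕ)) := rfl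
  have hvnorm (n : ℕ+) : ‖v n‖ ^ 2 = S := by
    have h := lp.norm_rpow_eq_tsum (p := 2) (by simp) (v n)
    simp only [ENNReal.toReal_ofNat, Real.rpow_two, hv] at h
    rw [h, hS, ← (injective_natCast_div n.pos).tsum_eq]
    · refine tsum_congr fun m => ?_
      rw [div_mul_cancel₀ _ (by simp), ratExtend_natCast]
    · intro q hq
      obtain ⟨m, hm, -⟩ := exists_of_ratExtend_ne_zero (c := c) (q := q * (n : ℕ)) (by
        intro h0; simp [h0] at hq)
      exact ⟨m, by simp [hm]⟩
  have hvorth (m n : ℕ+) (hmn : m ≠ n) : inner ℂ (v m) (v n) = 0 := by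
    have hm0 : ((m : ℕ) : ℚ) ≠ 0 := by simp
    have hn0 : ((n : ℕ) : ℚ) ≠ 0 := by simp
    rw [lp.inner_eq_tsum, ← h0 n m n.pos m.pos (by simpa using hmn.symm),
      ← (injective_natCast_div (Nat.mul_pos m.pos n.pos)).tsum_eq]
    · refine tsum_congr fun l => ?_
      have e1 : (l : ℚ) / ((m * n : ℕ) : ℚ) * (m : ℕ) = l / (n : ℕ) := by
        push_cast; field_simp
      have e2 : (l : ℚ) / ((m * n : ℕ) : ℚ) * (n : ℕ) = l / (m : ℕ) := by
        push_cast; field_simp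
      rw [hv, hv, e1, e2, RCLike.inner_apply, mul_comm]
    · intro q hq
      obtain ⟨l, hl, -⟩ := exists_of_ratExtend_ne_zero (c := c) (q := q * (m : ℕ)) (by
        intro h0; simp [hv, h0] at hq)
      refine ⟨l * n, ?_⟩
      push_cast
      rw [hl]
      field_simp
  have hon : Orthonormal ℂ fun n => ((√S : ℝ) : ℂ)⁻¹ • v n :=
    orthonormal_inv_norm_smul (r := fun _ => √S) (fun _ => (Real.sqrt_pos.2 hSpos).ne')
      (fun n => by rw [← hvnorm n, Real.sqrt_sq (norm_nonneg _)]) hvorth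
  let y : lp (fun _ : ℕ+ => ℂ) 2 :=
      ⟨fun n => conj (c n) * ((S⁻¹ - ((n : ℕ) : ℝ)⁻¹ * R⁻¹ : ℝ) : ℂ), memℓp_gen (by
    simp only [ENNReal.toReal_ofNat, Real.rpow_two]
    refine Summable.of_nonneg_of_le (fun n => by positivity) (fun n => ?_)
      ((hc.comp_injective PNat.coe_injective).mul_right ((S⁻¹ + R⁻¹) ^ 2))
    rw [norm_mul, RCLike.norm_conj, Complex.norm_real, mul_pow, Function.comp_apply]
    have h2 : ((n : ℕ) : ℝ)⁻¹ * R⁻¹ ≤ R⁻¹ :=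
      mul_le_of_le_one_left (by positivity) (Nat.cast_inv_le_one _)
    have h3 : 0 ≤ ((n : ℕ) : ℝ)⁻¹ * R⁻¹ := by positivity
    have h4 : 0 < S⁻¹ := by positivity
    gcongr
    rw [Real.norm_eq_abs, abs_le]
    constructor <;> linarith)⟩
  have hy (n : ℕ+) : y n = conj (c n) * ((S⁻¹ - ((n : ℕ) : ℝ)⁻¹ * R⁻¹ : ℝ) : ℂ) := rfl
  have hcomb (q : ℚ) : ∑' n : ℕ+, y n * ratExtend c (q * (n : ℕ)) = 0 := by
    rcases le_or_gt q 0 with hq | hq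
    · refine (tsum_congr fun n => ?_).trans tsum_zero
      by_contra hne
      obtain ⟨m, hm, hcm⟩ := exists_of_ratExtend_ne_zero (right_ne_zero_of_mul hne)
      have h5 : q * (n : ℕ) ≤ 0 := mul_nonpos_of_nonpos_of_nonneg hq (by positivity)
      have h6 : (0 : ℚ) < m := by exact_mod_cast hpos hcm
      linarith
    · obtain ⟨r, s, hr, hs, hrs, rfl⟩ : ∃ r s : ℕ, 0 < r ∧ 0 < s ∧ r.Coprime s ∧ q = r / s := by
        refine ⟨q.num.natAbs, q.den, ?_, q.pos, q.reduced, ?_⟩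
        · exact Int.natAbs_pos.2 (Rat.num_pos.2 hq).ne'
        · conv_lhs => rw [← Rat.num_div_den q]
          congr 1
          rw [Nat.cast_natAbs, abs_of_pos (Rat.num_pos.2 hq)]
      have hr' : (r : ℚ) ≠ 0 := by exact_mod_cast hr.ne'
      have hr'' : (r : ℂ) ≠ 0 := by exact_mod_cast hr.ne'
      have hs' : (s : ℚ) ≠ 0 := by exact_mod_cast hs.ne'
      have hsum := summable_conj_ratExtend_mul hc hr hs
      have hsum' : Summable fun n : ℕ =>
          (n : ℂ)⁻¹ * (conj (ratExtend c (n / r)) * ratExtend c (n / s)) := by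
        refine Summable.of_norm_bounded hsum.norm fun n => ?_
        rw [norm_mul, norm_inv, Complex.norm_natCast]
        exact mul_le_of_le_one_left (norm_nonneg _) (Nat.cast_inv_le_one n)
      have key : ∑' n : ℕ, ((S : ℂ)⁻¹ * (conj (ratExtend c (n / r)) * ratExtend c (n / s)) -
          (r * (R : ℂ)⁻¹) * ((n : ℂ)⁻¹ * (conj (ratExtend c (n / r)) * ratExtend c (n / s))))
          = 0 := by
        rw [(hsum.mul_left _).tsum_sub (hsum'.mul_left _), tsum_mul_left, tsum_mul_left]
        rcases eq_or_ne r s with rfl | hne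
        · obtain rfl : r = 1 := by simpa using hrs
          have hSc : (S : ℂ) ≠ 0 := by exact_mod_cast hSpos.ne'
          have hRc : (R : ℂ) ≠ 0 := by exact_mod_cast hRpos.ne'
          have e1 : ∑' n : ℕ, conj (ratExtend c (n / (1 : ℕ))) * ratExtend c (n / (1 : ℕ))
              = (S : ℂ) := by
            rw [hS, Complex.ofReal_tsum]
            refine tsum_congr fun n => ?_
            simp [RCLike.conj_mul]
          have e2 : ∑' n : ℕ, (n : ℂ)⁻¹ *
              (conj (ratExtend c (n / (1 : ℕ))) * ratExtend c (n / (1 : ℕ))) = (R : ℂ) := by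
            rw [hR, Complex.ofReal_tsum]
            refine tsum_congr fun n => ?_
            simp [RCLike.conj_mul]
          rw [e1, e2]
          simp [hSc, hRc]
        · rw [h0 r s hr hs hne, h1 r s hr hs hne]
          simp
      have hinj : Function.Injective fun n : ℕ+ => r * (n : ℕ) :=
        (mul_right_injective₀ hr.ne').comp PNat.coe_injective
      rw [← key, ← hinj.tsum_eq]
      · refine tsum_congr fun n => ?_
        have e3 : ((r * (n : ℕ) : ℕ) : ℚ) / r = (n : ℕ) := by push_cast; field_simp
        have e4 : ((r * (n : ℕ) : ℕ) : ℚ) / s = r / s * (n : ℕ) := by push_cast; field_simp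
        have hn' : ((n : ℕ) : ℂ) ≠ 0 := by simp
        rw [e3, e4, ratExtend_natCast, hy]
        push_cast
        field_simp
      · intro n hn
        obtain ⟨m, hm, hcm⟩ := exists_of_ratExtend_ne_zero (c := c) (q := n / r) (by
          intro h0; simp [h0] at hn)
        rw [eq_div_iff hr'] at hm
        lift m to ℕ+ using hpos hcm
        refine ⟨m, ?_⟩
        rw [mul_comm] at hm
        exact_mod_cast hm
  have hzero : hon.orthogonalFamily.linearIsometry y = 0 := by
    ext q
    have hs := (hon.orthogonalFamily.hasSum_linearIsometry y).mapL
      (lp.evalCLM ℂ (fun _ : ℚ => ℂ) 2 q)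
    have e : (fun n : ℕ+ => lp.evalCLM ℂ (fun _ : ℚ => ℂ) 2 q
        (LinearIsometry.toSpanSingleton ℂ (lp (fun _ : ℚ => ℂ) 2) (hon.1 n) (y n))) =
        fun n => ((√S : ℝ) : ℂ)⁻¹ * (y n * ratExtend c (q * (n : ℕ))) := by
      funext n
      change y n * (((√S : ℝ) : ℂ)⁻¹ * ratExtend c (q * (n : ℕ))) = _
      ring
    have := hs.tsum_eq
    rw [e, tsum_mul_left, hcomb q, mul_zero] at this
    exact this.symm
  have hy0 : y = 0 := hon.orthogonalFamily.linearIsometry.injective (by rw [hzero, map_zero])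
  have hfin {n : ℕ} (hn : c n ≠ 0) : (n : ℝ) = S / R := by
    lift n to ℕ+ using hpos hn
    have hn0 := n.pos
    have h7 := hy n
    rw [hy0, lp.coeFn_zero, Pi.zero_apply, eq_comm, mul_eq_zero] at h7
    have h8 := h7.resolve_left (by simpa using hn)
    have h9 : S⁻¹ - ((n : ℕ) : ℝ)⁻¹ * R⁻¹ = 0 := Complex.ofReal_eq_zero.1 h8
    field_simp at h9
    field_simp
    linarith
  exact_mod_cast (hfin ha).trans (hfin hb).symm

end ratExtend

lemma ae_dirichletMeasure_iff {t : ℝ} {p : ℕ → Prop} :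
    (∀ᵐ n ∂dirichletMeasure t, p n) ↔ ∀ n, p n := by
  have h (n : ℕ) : ¬ ENNReal.ofReal (((n : ℝ) + 2) ^ t) = 0 := by
    rw [ENNReal.ofReal_eq_zero, not_le]; positivity
  simp only [dirichletMeasure, Measure.ae_sum_iff, Measure.ae_ennreal_smul_measure_iff (h _), ae_dirac_eq,
    Filter.eventually_pure]

lemma DirichletSpace.hasSum_inner {t : ℝ} (g h : DirichletSpace t) :
    HasSum (fun n : ℕ => (((n : ℝ) + 2) ^ t) • inner ℂ ((g : ℕ → ℂ) n) ((h : ℕ → ℂ) n))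
      (inner ℂ g h) := by
  rw [L2.inner_def]
  have hi := L2.integrable_inner (𝕜 := ℂ) g h
  refine (hasSum_integral_measure hi).congr_fun ?_
  intro n
  have : (0 : ℝ) ≤ ((n : ℝ) + 2) ^ t := by positivity
  simp [integral_smul_measure, ENNReal.toReal_ofReal this]

lemma DirichletSpace.ext {t : ℝ} {g h : DirichletSpace t}
    (H : ∀ n, (g : ℕ → ℂ) n = (h : ℕ → ℂ) n) : g = h :=
  Lp.ext (ae_dirichletMeasure_iff.2 H)

lemma DirichletSpace.hasSum_norm_sq {t : ℝ} (g : DirichletSpace t) :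
    HasSum (fun n : ℕ => (((n : ℝ) + 2) ^ t) * ‖(g : ℕ → ℂ) n‖ ^ 2) (‖g‖ ^ 2) := by
  have h := Complex.hasSum_re (DirichletSpace.hasSum_inner g g)
  rw [← RCLike.re_eq_complex_re, inner_self_eq_norm_sq] at h
  convert h using 2 with n
  rw [RCLike.smul_re, inner_self_eq_norm_sq]

lemma DirichletSpace.norm_sq_of_eq_single {t : ℝ} {g : DirichletSpace t} {m : ℕ} {c : ℂ}
    (hg : ∀ n, (g : ℕ → ℂ) n = if n = m then c else 0) : ‖g‖ ^ 2 = ((m : ℝ) + 2) ^ t * ‖c‖ ^ 2 := by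
  refine (DirichletSpace.hasSum_norm_sq g).unique ?_
  convert hasSum_single m fun n hn => ?_ using 1
  · simp [hg]
  · simp [hg, hn]

lemma DirichletSpace.inner_of_eq_single {t : ℝ} {g h : DirichletSpace t} {m : ℕ} {c : ℂ}
    (hg : ∀ n, (g : ℕ → ℂ) n = if n = m then c else 0) :
    inner ℂ g h = (((m : ℝ) + 2) ^ t) • inner ℂ c ((h : ℕ → ℂ) m) := by
  refine (DirichletSpace.hasSum_inner g h).unique ?_
  convert hasSum_single m fun n hn => ?_ using 1
  · simp [hg]
  · simp [hg, hn]

lemma rpow_half_sq {x : ℝ} (hx : 0 ≤ x) (t : ℝ) : (x ^ (t / 2)) ^ 2 = x ^ t := by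
  rw [← Real.rpow_natCast, ← Real.rpow_mul hx]
  norm_num

section Dilates

open ComplexConjugate

variable {t : ℝ} {f : DirichletSpace t} {fdil : ℕ → DirichletSpace t}

/-- Mutually orthogonal dilates force `f` to have at most one nonzero Taylor coefficient. -/
lemma eq_of_ne_zero_of_inner_dilates_eq_zero (ht : t ≠ 0)
    (hfdil : ∀ k n : ℕ, (fdil k : ℕ → ℂ) n =
      if (k + 1) ∣ (n + 1) then (f : ℕ → ℂ) ((n + 1) / (k + 1) - 1) else 0)
    (ho : ∀ j k, j ≠ k → inner ℂ (fdil j) (fdil k) = 0) {a b : ℕ}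
    (ha : (f : ℕ → ℂ) a ≠ 0) (hb : (f : ℕ → ℂ) b ≠ 0) : a = b := by
  set c : ℕ → ℂ := fun n => if n = 0 then 0 else (((n : ℝ) ^ (t / 2) : ℝ) : ℂ) * (f : ℕ → ℂ) (n - 1)
    with hc_def
  have hc0 : c 0 = 0 := by simp [hc_def]
  have hcsucc (n : ℕ) : c (n + 1) = ((((n + 1 : ℕ) : ℝ) ^ (t / 2) : ℝ) : ℂ) * (f : ℕ → ℂ) n := by
    simp [hc_def]
  have hc : Summable fun n => ‖c n‖ ^ 2 := by
    rw [← summable_nat_add_iff 1]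
    refine Summable.of_nonneg_of_le (fun n => by positivity) (fun n => ?_)
      ((DirichletSpace.hasSum_norm_sq f).summable.mul_left (2 ^ |t|))
    rw [hcsucc, norm_mul, mul_pow, Complex.norm_real, Real.norm_of_nonneg (by positivity),
      rpow_half_sq (by positivity), ← mul_assoc]
    gcongr
    push_cast
    have h1 : (0 : ℝ) < n + 1 := by positivity
    have h2 : (0 : ℝ) < n + 2 := by positivity
    rcases le_total 0 t with h | h
    · calc ((n : ℝ) + 1) ^ t ≤ (n + 2) ^ t := by gcongr; norm_num
        _ ≤ 2 ^ |t| * (n + 2) ^ t :=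
          le_mul_of_one_le_left (by positivity) (Real.one_le_rpow (by norm_num) (abs_nonneg _))
    · rw [abs_of_nonpos h, Real.rpow_neg (by norm_num), ← Real.inv_rpow (by norm_num),
        ← Real.mul_rpow (by norm_num) h2.le]
      exact Real.rpow_le_rpow_of_nonpos (by positivity) (by linarith) h
  have hext (k n : ℕ) : ratExtend c ((n + 1 : ℕ) / (k + 1 : ℕ)) =
      (((((n + 1 : ℕ) : ℝ) / (k + 1 : ℕ)) ^ (t / 2) : ℝ) : ℂ) * (fdil k : ℕ → ℂ) n := by
    rw [ratExtend_div k.succ_pos, hfdil]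
    split_ifs with h
    · obtain ⟨m, hm⟩ := h
      have hm0 : m ≠ 0 := by rintro rfl; simp at hm
      rw [hm, Nat.mul_div_cancel_left _ k.succ_pos]
      simp only [hc_def, hm0, if_false]
      congr 3
      push_cast
      field_simp
    · simp
  have hH (j k : ℕ) (hj : 0 < j) (hk : 0 < k) (hjk : j ≠ k) :
      ∑' n : ℕ, (((1 + 1 / n : ℝ) ^ t : ℝ) : ℂ) *
        (conj (ratExtend c (n / j)) * ratExtend c (n / k)) = 0 := by
    obtain ⟨j, rfl⟩ := Nat.exists_eq_add_one.2 hj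
    obtain ⟨k, rfl⟩ := Nat.exists_eq_add_one.2 hk
    rw [← Nat.succ_injective.tsum_eq]
    · have hs := (DirichletSpace.hasSum_inner (fdil j) (fdil k)).tsum_eq
      rw [ho j k (by simpa using hjk)] at hs
      have e (n : ℕ) : (((1 + 1 / (n.succ : ℕ) : ℝ) ^ t : ℝ) : ℂ) *
          (conj (ratExtend c ((n.succ : ℕ) / (j + 1 : ℕ))) *
            ratExtend c ((n.succ : ℕ) / (k + 1 : ℕ))) =
          (((((j + 1 : ℕ) : ℝ) * (k + 1 : ℕ)) ^ (-(t / 2)) : ℝ) : ℂ) *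
            ((((n : ℝ) + 2) ^ t) • inner ℂ ((fdil j : ℕ → ℂ) n) ((fdil k : ℕ → ℂ) n)) := by
        have er : (1 + 1 / ((n + 1 : ℕ) : ℝ)) ^ t * ((((n + 1 : ℕ) : ℝ) / (j + 1 : ℕ)) ^ (t / 2) *
            (((n + 1 : ℕ) : ℝ) / (k + 1 : ℕ)) ^ (t / 2)) =
            (((j + 1 : ℕ) : ℝ) * (k + 1 : ℕ)) ^ (-(t / 2)) * ((n : ℝ) + 2) ^ t := by
          rw [← rpow_half_sq (by positivity) t, ← rpow_half_sq (x := (n : ℝ) + 2) (by positivity) t,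
            Real.rpow_neg (by positivity), ← Real.inv_rpow (by positivity), sq, sq,
            ← Real.mul_rpow (by positivity) (by positivity),
            ← Real.mul_rpow (by positivity) (by positivity),
            ← Real.mul_rpow (by positivity) (by positivity),
            ← Real.mul_rpow (by positivity) (by positivity),
            ← Real.mul_rpow (by positivity) (by positivity)]
          congr 1
          push_cast
          field_simp
          ring
        rw [Nat.succ_eq_add_one, hext, hext, Complex.real_smul, RCLike.inner_apply, map_mul,
          Complex.conj_ofReal]
        have er' := congrArg (fun x : ℝ => (x : ℂ)) er
        simp only [Complex.ofReal_mul] at er'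
        linear_combination (conj ((fdil j : ℕ → ℂ) n) * (fdil k : ℕ → ℂ) n) * er'
      rw [tsum_congr e, tsum_mul_left, hs, mul_zero]
    · intro n hn
      rcases n with _ | n
      · exact absurd (by simpa [hc0] using ratExtend_natCast (c := c) 0)
          (fun h0 : ratExtend c 0 = 0 => hn (by simp [h0]))
      · exact ⟨n, rfl⟩
  have hboth (j k : ℕ) (hj : 0 < j) (hk : 0 < k) (hjk : j ≠ k) :=
    tsum_eq_zero_of_rpow_dilates ht (summable_conj_ratExtend_mul hc hj hk) fun d hd => by
      rw [← tsum_conj_ratExtend_mul_dilate (fun x => (1 + x) ^ t) hd hj]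
      exact hH _ _ (Nat.mul_pos hd hj) (Nat.mul_pos hd hk)
        fun h => hjk (Nat.eq_of_mul_eq_mul_left hd h)
  have hne {n : ℕ} (hn : (f : ℕ → ℂ) n ≠ 0) : c (n + 1) ≠ 0 := by
    rw [hcsucc]
    exact mul_ne_zero (Complex.ofReal_ne_zero.2 (by positivity)) hn
  exact Nat.succ_injective (eq_of_ne_zero_of_orthogonal_dilates hc0 hc
    (fun j k hj hk hjk => (hboth j k hj hk hjk).1) (fun j k hj hk hjk => (hboth j k hj hk hjk).2)
    (hne ha) (hne hb))

lemma dilate_eq_single {N : ℕ} {c : ℂ}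
    (hfdil : ∀ k n : ℕ, (fdil k : ℕ → ℂ) n =
      if (k + 1) ∣ (n + 1) then (f : ℕ → ℂ) ((n + 1) / (k + 1) - 1) else 0)
    (hf : ∀ n, (f : ℕ → ℂ) n = if n = N then c else 0) (k n : ℕ) :
    (fdil k : ℕ → ℂ) n = if n = (k + 1) * (N + 1) - 1 then c else 0 := by
  rw [hfdil]
  have hpos : 0 < (k + 1) * (N + 1) := by positivity
  by_cases hn : n = (k + 1) * (N + 1) - 1
  · have h1 : n + 1 = (k + 1) * (N + 1) := by omega
    rw [h1, if_pos (Dvd.intro _ rfl), Nat.mul_div_cancel_left _ k.succ_pos, hf, if_pos hn]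
    simp
  · rw [if_neg hn]
    split_ifs with h
    · obtain ⟨m, hm⟩ := h
      rw [hm, Nat.mul_div_cancel_left _ k.succ_pos, hf, if_neg]
      rintro rfl
      have hm0 : m ≠ 0 := by rintro rfl; simp at hm
      apply hn
      rw [Nat.sub_add_cancel (Nat.one_le_iff_ne_zero.2 hm0), ← hm]
      simp
    · rfl

lemma norm_sq_dilate {N : ℕ} {c : ℂ}
    (hfdil : ∀ k n : ℕ, (fdil k : ℕ → ℂ) n =
      if (k + 1) ∣ (n + 1) then (f : ℕ → ℂ) ((n + 1) / (k + 1) - 1) else 0)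
    (hf : ∀ n, (f : ℕ → ℂ) n = if n = N then c else 0) (k : ℕ) :
    ‖fdil k‖ ^ 2 = (((k : ℝ) + 1) * ((N : ℝ) + 1) + 1) ^ t * ‖c‖ ^ 2 := by
  rw [DirichletSpace.norm_sq_of_eq_single (dilate_eq_single hfdil hf k)]
  congr 2
  rw [Nat.cast_sub (Nat.one_le_iff_ne_zero.2 (by positivity))]
  push_cast
  ring

end Dilates

/-- Suppose `t ≠ 0` and `f ∈ D_t` (with `‖f‖_{D_t} = 1`).  The operator
equations `T z^k = λ_k f(z^k)` (`k = 1, 2, …`) have a solution `T` that is an isometry on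
`D_t` if and only if `f = c z^N` for some positive integer `N` and constant `c` with
`|c| = (N+1)^{-t/2}`, and `|λ_k| = ((kN + k + N + 1)/(kN + 1))^{t/2}` for each `k`.
Here `zpow k` is the monomial `z^{k+1}` and `fdil k` is `f(z^{k+1})` (indices shifted by
one), and `N + 1`, `k + 1` play the roles of `N`, `k`. -/
theorem isometric_moment_problem (t : ℝ) (ht : t ≠ 0)
    (f : DirichletSpace t) (hf1 : ‖f‖ = 1)
    (zpow : ℕ → DirichletSpace t)
    (hzpow : ∀ k n : ℕ, (zpow k : ℕ → ℂ) n = if n = k then 1 else 0)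
    (fdil : ℕ → DirichletSpace t)
    (hfdil : ∀ k n : ℕ, (fdil k : ℕ → ℂ) n =
      if (k + 1) ∣ (n + 1) then (f : ℕ → ℂ) ((n + 1) / (k + 1) - 1) else 0)
    (lam : ℕ → ℂ) :
    (∃ T : DirichletSpace t →ₗᵢ[ℂ] DirichletSpace t, ∀ k : ℕ, T (zpow k) = lam k • fdil k)
      ↔
    (∃ (N : ℕ) (c : ℂ),
      (∀ n : ℕ, (f : ℕ → ℂ) n = if n = N then c else 0) ∧
      ‖c‖ = ((N : ℝ) + 2) ^ (-(t / 2)) ∧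
      ∀ k : ℕ, ‖lam k‖ =
        ((((k : ℝ) + 1) * ((N : ℝ) + 1) + ((k : ℝ) + 1) + ((N : ℝ) + 1) + 1) /
          (((k : ℝ) + 1) * ((N : ℝ) + 1) + 1)) ^ (t / 2)) := by
  have hznorm (k : ℕ) : ‖zpow k‖ ^ 2 = ((k : ℝ) + 2) ^ t := by
    simpa using DirichletSpace.norm_sq_of_eq_single (hzpow k)
  have hz0 (k : ℕ) : zpow k ≠ 0 := by
    intro h
    have h1 := hznorm k
    have h2 : 0 < ((k : ℝ) + 2) ^ t := by positivity
    rw [h, norm_zero] at h1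
    norm_num at h1
    linarith
  have hzinner (j k : ℕ) (hjk : j ≠ k) : inner ℂ (zpow j) (zpow k) = 0 := by
    rw [DirichletSpace.inner_of_eq_single (hzpow j), hzpow, if_neg hjk]
    simp
  have hratio (k N : ℕ) : ((((((k : ℝ) + 1) * ((N : ℝ) + 1) + ((k : ℝ) + 1) + ((N : ℝ) + 1) + 1) /
      (((k : ℝ) + 1) * ((N : ℝ) + 1) + 1)) ^ (t / 2)) ^ 2) *
      (((k : ℝ) + 1) * ((N : ℝ) + 1) + 1) ^ t = ((k : ℝ) + 2) ^ t * ((N : ℝ) + 2) ^ t := by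
    rw [rpow_half_sq (by positivity), ← Real.mul_rpow (by positivity) (by positivity),
      ← Real.mul_rpow (by positivity) (by positivity)]
    congr 1
    field_simp
    ring
  have hcnorm (N : ℕ) : (((N : ℝ) + 2) ^ (-(t / 2))) ^ 2 * ((N : ℝ) + 2) ^ t = 1 := by
    rw [Real.rpow_neg (by positivity), inv_pow, rpow_half_sq (by positivity)]
    exact inv_mul_cancel₀ (by positivity)
  constructor
  · rintro ⟨T, hT⟩
    have hlam (k : ℕ) : lam k ≠ 0 := by
      intro h
      have h1 := hT k
      rw [h, zero_smul] at h1
      exact hz0 k (T.injective (by rw [h1, map_zero]))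
    have ho (j k : ℕ) (hjk : j ≠ k) : inner ℂ (fdil j) (fdil k) = 0 := by
      have h1 := T.inner_map_map (zpow j) (zpow k)
      rw [hT, hT, hzinner j k hjk, inner_smul_left, inner_smul_right] at h1
      simpa [hlam] using h1
    obtain ⟨N, hN⟩ : ∃ N, (f : ℕ → ℂ) N ≠ 0 := by
      by_contra! h
      have h1 := (DirichletSpace.hasSum_norm_sq f).tsum_eq
      simp [h, hf1] at h1
    have hf (n : ℕ) : (f : ℕ → ℂ) n = if n = N then (f : ℕ → ℂ) N else 0 := by
      split_ifs with h
      · rw [h]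
      · by_contra hne
        exact h (eq_of_ne_zero_of_inner_dilates_eq_zero ht hfdil ho hne hN)
    have hfN := DirichletSpace.norm_sq_of_eq_single hf
    rw [hf1, one_pow] at hfN
    refine ⟨N, (f : ℕ → ℂ) N, hf, ?_, fun k => ?_⟩
    · have h2 : ((N : ℝ) + 2) ^ t ≠ 0 := by positivity
      rw [← sq_eq_sq₀ (norm_nonneg _) (by positivity)]
      apply mul_right_cancel₀ h2
      rw [hcnorm]
      linarith
    · have h1 : ‖lam k‖ ^ 2 * ‖fdil k‖ ^ 2 = ((k : ℝ) + 2) ^ t := by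
        rw [← mul_pow, ← norm_smul, ← hT, T.norm_map, hznorm]
      rw [norm_sq_dilate hfdil hf] at h1
      have h2 : (((k : ℝ) + 1) * ((N : ℝ) + 1) + 1) ^ t ≠ 0 := by positivity
      rw [← sq_eq_sq₀ (norm_nonneg _) (by positivity)]
      apply mul_right_cancel₀ h2
      rw [hratio, ← h1]
      linear_combination
        (‖lam k‖ ^ 2 * (((k : ℝ) + 1) * ((N : ℝ) + 1) + 1) ^ t) * hfN
  · rintro ⟨N, c, hf, hc, hlam⟩
    refine exists_linearIsometry_of_orthogonal hzinner hz0 (fun g hg => ?_) (fun j k hjk => ?_)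
      fun k => ?_
    · refine DirichletSpace.ext fun n => ?_
      have h1 := hg n
      rw [DirichletSpace.inner_of_eq_single (hzpow n), smul_eq_zero] at h1
      rw [ae_dirichletMeasure_iff.1 (Lp.coeFn_zero ℂ 2 (dirichletMeasure t)) n]
      simpa using h1.resolve_left (by positivity)
    · rw [inner_smul_left, inner_smul_right,
        DirichletSpace.inner_of_eq_single (dilate_eq_single hfdil hf j),
        dilate_eq_single hfdil hf k, if_neg]
      · simp
      · intro h
        have hj : 0 < (j + 1) * (N + 1) := by positivity
        have hk : 0 < (k + 1) * (N + 1) := by positivity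
        have h2 : (j + 1) * (N + 1) = (k + 1) * (N + 1) := by omega
        have h3 := Nat.eq_of_mul_eq_mul_right N.succ_pos h2
        omega
    · rw [← sq_eq_sq₀ (norm_nonneg _) (norm_nonneg _), norm_smul, mul_pow,
        norm_sq_dilate hfdil hf, hznorm, hlam, ← mul_assoc, hratio, hc]
      linear_combination ((k : ℝ) + 2) ^ t * hcnorm N
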